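/- Hall numbers satisfy associativity: for objects A, B, C, S in an abelian category with finite Hall numbers, Σ_X F^X_{A,B} F^S_{X,C} = Σ_X F^S_{A,X} F^X_{B,C}, where both sums range over isomorphism classes of objects X. -/

import Mathlib

open CategoryTheory CategoryTheory.Limits
open scoped BigOperators

/-- The Hall number F^Z_{X,Y}: the number of subobjects U ⊆ Z with U ≅ Y and Z/U ≅ X. -/
noncomputable def hallNumber {C : Type*} [Category C] [Abelian C] (Z X Y : C) : ℕ :=
  Nat.card {U : Subobject Z // Nonempty ((U : C) ≅ Y) ∧ Nonempty (cokernel U.arrow ≅ X)}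

section HallNumbers

variable {C : Type*} [Category C]

/-- A subobject is determined by its inclusion, up to an isomorphism of its underlying object. -/
lemma finite_subobject_underlying_iso [∀ A B : C, Finite (A ⟶ B)] (Z Y : C) :
    Finite {U : Subobject Z // Nonempty ((U : C) ≅ Y)} := by
  refine Finite.of_injective (β := Y ⟶ Z) (fun U => U.2.some.inv ≫ U.1.arrow) fun U V h => ?_
  refine Subtype.ext (Subobject.eq_of_comm (U.2.some ≪≫ V.2.some.symm) ?_)
  simpa using (U.2.some.inv_comp_eq.mp h).symm

lemma nonempty_iso_congr_left {X X' Y : C} (e : X ≅ X') :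
    Nonempty (X ≅ Y) ↔ Nonempty (X' ≅ Y) :=
  ⟨fun ⟨i⟩ => ⟨e.symm ≪≫ i⟩, fun ⟨i⟩ => ⟨e ≪≫ i⟩⟩

lemma subobject_map_eq_mk {Y Z : C} (f : Y ⟶ Z) [Mono f] (U : Subobject Y) :
    (Subobject.map f).obj U = Subobject.mk (U.arrow ≫ f) := by
  conv_lhs => rw [← Subobject.mk_arrow U]
  rw [Subobject.map_mk]

lemma finsum_mul_card_fiber {ι P : Type*} [Fintype P] (c : P → ι) (f : ι → ℕ) :
    ∑ᶠ i, f i * Nat.card {v // c v = i} = ∑ v, f (c v) := by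
  classical
  rw [Finset.sum_comp f c, finsum_eq_sum_of_support_subset (s := Finset.univ.image c)]
  · refine Finset.sum_congr rfl fun i _ => ?_
    rw [Nat.card_eq_fintype_card, Fintype.card_subtype, smul_eq_mul, mul_comm]
  · intro i hi
    have : Nat.card {v // c v = i} ≠ 0 := right_ne_zero_of_mul hi
    obtain ⟨⟨v, hv⟩⟩ := (Nat.card_ne_zero.mp this).1
    simpa using ⟨v, hv⟩

/-- A sum over isomorphism classes, weighted by the number of members of a finite family in
each class, is a sum over the family. -/
lemma finsum_mul_card_iso {ι P : Type*} [Fintype P] {rep : ι → C}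
    (hrep : ∀ Z : C, ∃! i : ι, Nonempty (Z ≅ rep i)) (Q : P → C) (f : C → ℕ)
    (hf : ∀ {X Y : C}, (X ≅ Y) → f X = f Y) :
    ∑ᶠ i, f (rep i) * Nat.card {v // Nonempty (Q v ≅ rep i)} = ∑ v, f (Q v) := by
  choose c hc huniq using fun v => hrep (Q v)
  have hcard (i : ι) : Nat.card {v // Nonempty (Q v ≅ rep i)} = Nat.card {v // c v = i} :=
    Nat.card_congr (Equiv.subtypeEquivRight fun v =>
      ⟨fun h => (huniq v i h).symm, fun h => h ▸ hc v⟩)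
  simp_rw [hcard]
  rw [finsum_mul_card_fiber c fun i => f (rep i)]
  exact Finset.sum_congr rfl fun v _ => (hf (hc v).some).symm

variable [Abelian C]

lemma subobject_le_of_arrow_comp_cokernel_eq_zero {Z : C} {V W : Subobject Z}
    (h : V.arrow ≫ cokernel.π W.arrow = 0) : V ≤ W :=
  Subobject.le_of_comm (Abelian.monoLift W.arrow V.arrow h) (Abelian.monoLift_comp _ _ _)

/-- A subobject is determined by the projection onto its quotient, up to an isomorphism
of the quotient. -/
lemma finite_subobject_cokernel_iso [∀ A B : C, Finite (A ⟶ B)] (Z X : C) :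
    Finite {U : Subobject Z // Nonempty (cokernel U.arrow ≅ X)} := by
  have key : ∀ U V : {U : Subobject Z // Nonempty (cokernel U.arrow ≅ X)},
      cokernel.π U.1.arrow ≫ U.2.some.hom = cokernel.π V.1.arrow ≫ V.2.some.hom →
        U.1 ≤ V.1 := fun U V h => by
    refine subobject_le_of_arrow_comp_cokernel_eq_zero ?_
    rw [← cancel_mono V.2.some.hom, Category.assoc, ← h]
    simp
  exact Finite.of_injective (β := Z ⟶ X) (fun U => cokernel.π U.1.arrow ≫ U.2.some.hom)
    fun U V h => Subtype.ext (le_antisymm (key U V h) (key V U h.symm))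

/-- The quotient by a subobject presented by a monomorphism. -/
noncomputable def cokernelMkArrowIso {Y Z : C} (f : Y ⟶ Z) [Mono f] :
    cokernel (Subobject.mk f).arrow ≅ cokernel f :=
  cokernel.mapIso _ _ (Subobject.underlyingIso f) (Iso.refl _) (by simp)

lemma hallNumber_congr_iso {Z Z' : C} (e : Z ≅ Z') (X Y : C) :
    hallNumber Z X Y = hallNumber Z' X Y := by
  refine Nat.card_congr ((Subobject.mapIsoToOrderIso e).toEquiv.subtypeEquiv fun U => ?_)
  have h : (Subobject.mapIsoToOrderIso e).toEquiv U = Subobject.mk (U.arrow ≫ e.hom) :=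
    subobject_map_eq_mk e.hom U
  rw [h]
  exact and_congr (nonempty_iso_congr_left (Subobject.underlyingIso (U.arrow ≫ e.hom)).symm)
    (nonempty_iso_congr_left (cokernelMkArrowIso (U.arrow ≫ e.hom) ≪≫
      cokernelCompIsIso U.arrow e.hom).symm)

lemma le_pullback_cokernel {S : C} (V : Subobject S) (T : Subobject (cokernel V.arrow)) :
    V ≤ (Subobject.pullback (cokernel.π V.arrow)).obj T :=
  Subobject.le_of_comm ((Subobject.isPullback (cokernel.π V.arrow) T).lift 0 V.arrow (by simp))
    (IsPullback.lift_snd _ _ _ _)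

instance epi_pullbackπ {Y Z : C} (p : Y ⟶ Z) [Epi p] (T : Subobject Z) :
    Epi (Subobject.pullbackπ p T) :=
  Abelian.epi_fst_of_isLimit _ _ (Subobject.isPullback p T).isLimit

lemma image_pullback_eq {Y Z : C} (p : Y ⟶ Z) [Epi p] (T : Subobject Z) :
    imageSubobject (((Subobject.pullback p).obj T).arrow ≫ p) = T := by
  rw [← (Subobject.isPullback p T).w]
  refine le_antisymm (imageSubobject_le _ (Subobject.pullbackπ p T) rfl) ?_
  apply subobject_le_of_arrow_comp_cokernel_eq_zero
  have h := imageSubobject_arrow_comp (Subobject.pullbackπ p T ≫ T.arrow)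
  rw [← cancel_epi (Subobject.pullbackπ p T), comp_zero, ← Category.assoc]
  exact (congrArg (· ≫ cokernel.π _) h).symm.trans
    (by rw [Category.assoc, cokernel.condition, comp_zero])

lemma pullback_image_eq {S : C} {V W : Subobject S} (h : V ≤ W) :
    (Subobject.pullback (cokernel.π V.arrow)).obj
      (imageSubobject (W.arrow ≫ cokernel.π V.arrow)) = W := by
  have hq : V.arrow ≫ cokernel.π W.arrow = 0 := by
    rw [← Subobject.ofLE_arrow h, Category.assoc, cokernel.condition, comp_zero]
  have hT : (imageSubobject (W.arrow ≫ cokernel.π V.arrow)).arrow ≫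
      cokernel.desc V.arrow _ hq = 0 :=
    imageSubobject_arrow_comp_eq_zero (by simp)
  refine le_antisymm (subobject_le_of_arrow_comp_cokernel_eq_zero ?_) ?_
  · rw [← cokernel.π_desc V.arrow _ hq, ← Category.assoc, ← (Subobject.isPullback _ _).w,
      Category.assoc, hT, comp_zero]
  · exact Subobject.le_of_comm ((Subobject.isPullback _ _).lift (factorThruImageSubobject _)
      W.arrow (by simp)) (IsPullback.lift_snd _ _ _ _)

/-- The correspondence between subobjects of `S / V` and subobjects of `S` containing `V`. -/
noncomputable def subobjectCokernelEquiv {S : C} (V : Subobject S) :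
    Subobject (cokernel V.arrow) ≃ Set.Ici V where
  toFun T := ⟨(Subobject.pullback (cokernel.π V.arrow)).obj T, le_pullback_cokernel V T⟩
  invFun W := imageSubobject (W.1.arrow ≫ cokernel.π V.arrow)
  left_inv T := image_pullback_eq _ T
  right_inv W := Subtype.ext (pullback_image_eq W.2)

/-- The third isomorphism theorem for the preimage of a subobject under an epimorphism. -/
lemma nonempty_cokernel_pullback_iso {Y Z : C} (p : Y ⟶ Z) [Epi p] (T : Subobject Z) :
    Nonempty (cokernel T.arrow ≅ cokernel ((Subobject.pullback p).obj T).arrow) := by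
  have sq := (Subobject.isPullback p T).flip
  have := Abelian.mono_cokernel_map_of_isPullback sq
  have : Epi (cokernel.map _ _ _ _ sq.w) := by
    have : Epi (cokernel.π ((Subobject.pullback p).obj T).arrow ≫ cokernel.map _ _ _ _ sq.w) := by
      rw [cokernel.π_desc]
      infer_instance
    exact epi_of_epi (cokernel.π ((Subobject.pullback p).obj T).arrow) _
  have := isIso_of_mono_of_epi (cokernel.map _ _ _ _ sq.w)
  exact ⟨(asIso (cokernel.map _ _ _ _ sq.w)).symm⟩

lemma nonempty_iso_cokernel_ofLE_pullback {S : C} (V : Subobject S)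
    (T : Subobject (cokernel V.arrow)) :
    Nonempty ((T : C) ≅ cokernel (Subobject.ofLE _ _ (le_pullback_cokernel V T))) := by
  have w : Subobject.ofLE _ _ (le_pullback_cokernel V T) ≫
      Subobject.pullbackπ (cokernel.π V.arrow) T = 0 := by
    rw [← cancel_mono T.arrow, Category.assoc, (Subobject.isPullback _ T).w]
    simp
  have hk {K : C} (k : K ⟶ ((Subobject.pullback (cokernel.π V.arrow)).obj T : C))
      (hk : k ≫ Subobject.pullbackπ (cokernel.π V.arrow) T = 0) :
      (k ≫ ((Subobject.pullback (cokernel.π V.arrow)).obj T).arrow) ≫ cokernel.π V.arrow = 0 := by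
    rw [Category.assoc, ← (Subobject.isPullback _ T).w, reassoc_of% hk, zero_comp]
  have hlim : IsLimit (KernelFork.ofι _ w) := KernelFork.IsLimit.ofι' _ _ fun {K} k h =>
    ⟨Abelian.monoLift V.arrow _ (hk k h), by
      rw [← cancel_mono ((Subobject.pullback (cokernel.π V.arrow)).obj T).arrow, Category.assoc,
        Subobject.ofLE_arrow, Abelian.monoLift_comp]⟩
  exact ⟨(Abelian.epiIsCokernelOfKernel _ hlim).coconePointUniqueUpToIso (colimit.isColimit _)⟩

/-- Two-step filtrations `V ≤ W ≤ S` with `W / V ≅ B` and `S / W ≅ A`, counted by `W / V`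
inside `S / V`. -/
lemma card_quotient_filtrations (A B : C) {S : C} (V : Subobject S) :
    hallNumber (cokernel V.arrow) A B =
      Nat.card {W : Set.Ici V // Nonempty (cokernel (Subobject.ofLE V W.1 W.2) ≅ B) ∧
        Nonempty (cokernel W.1.arrow ≅ A)} :=
  Nat.card_congr ((subobjectCokernelEquiv V).subtypeEquiv fun T =>
    and_congr (nonempty_iso_congr_left (nonempty_iso_cokernel_ofLE_pullback V T).some)
      (nonempty_iso_congr_left (nonempty_cokernel_pullback_iso (cokernel.π V.arrow) T).some))

/-- Two-step filtrations `V ≤ W ≤ S` with `W / V ≅ B` and `V ≅ D`, counted by `V` inside `W`. -/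
lemma card_subobject_filtrations (B D : C) {S : C} (W : Subobject S) :
    hallNumber (W : C) B D =
      Nat.card {V : Set.Iic W // Nonempty ((V.1 : C) ≅ D) ∧
        Nonempty (cokernel (Subobject.ofLE V.1 W V.2) ≅ B)} := by
  refine (Nat.card_congr ((Subobject.subobjectOrderIso W).symm.toEquiv.subtypeEquiv
    fun V => ?_)).symm
  have hVW : V.1 ≤ W := V.2
  have h : (Subobject.subobjectOrderIso W).symm.toEquiv V =
    Subobject.mk (Subobject.ofLE V.1 W hVW) := rfl
  rw [h]
  exact and_congr
    (nonempty_iso_congr_left (Subobject.underlyingIso (Subobject.ofLE V.1 W hVW)).symm)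
    (nonempty_iso_congr_left (cokernelMkArrowIso (Subobject.ofLE V.1 W hVW)).symm)

end HallNumbers

/-- associativity of Hall numbers: with sums over a complete set of
representatives of isomorphism classes, Σ_X F^X_{A,B} F^S_{X,C} = Σ_X F^S_{A,X} F^X_{B,C};
all Hall numbers are finite (finite Hom-sets) and only finitely many isomorphism
classes contribute to each sum. -/
theorem hall_numbers_associative {C : Type*} [Category C] [Abelian C]
    [∀ A B : C, Finite (A ⟶ B)]
    {ι : Type*} (rep : ι → C) (hrep : ∀ Z : C, ∃! i : ι, Nonempty (Z ≅ rep i))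
    (A B Cc S : C)
    (hfin₁ : {i : ι | hallNumber (rep i) A B ≠ 0}.Finite)
    (hfin₂ : {i : ι | hallNumber (rep i) B Cc ≠ 0}.Finite) :
    ∑ᶠ i : ι, hallNumber (rep i) A B * hallNumber S (rep i) Cc =
      ∑ᶠ i : ι, hallNumber S A (rep i) * hallNumber (rep i) B Cc := by
  have := finite_subobject_underlying_iso S Cc
  have := finite_subobject_cokernel_iso S A
  let := Fintype.ofFinite {V : Subobject S // Nonempty ((V : C) ≅ Cc)}
  let := Fintype.ofFinite {W : Subobject S // Nonempty (cokernel W.arrow ≅ A)}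
  have hl (i : ι) : hallNumber S (rep i) Cc =
      Nat.card {V : {V : Subobject S // Nonempty ((V : C) ≅ Cc)} //
        Nonempty (cokernel V.1.arrow ≅ rep i)} :=
    (Nat.card_congr (Equiv.subtypeSubtypeEquivSubtypeInter _ _)).symm
  have hr (i : ι) : hallNumber S A (rep i) =
      Nat.card {W : {W : Subobject S // Nonempty (cokernel W.arrow ≅ A)} //
        Nonempty ((W.1 : C) ≅ rep i)} :=
    (Nat.card_congr ((Equiv.subtypeSubtypeEquivSubtypeInter _
      fun W : Subobject S => Nonempty ((W : C) ≅ rep i)).trans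
        (Equiv.subtypeEquivRight fun _ => and_comm))).symm
  have finl (V : Subobject S) : Finite {W : Set.Ici V //
      Nonempty (cokernel (Subobject.ofLE V W.1 W.2) ≅ B) ∧ Nonempty (cokernel W.1.arrow ≅ A)} :=
    Finite.of_injective (β := {W : Subobject S // Nonempty (cokernel W.arrow ≅ A)})
      (fun W => ⟨W.1.1, W.2.2⟩)
      fun _ _ h => Subtype.ext (Subtype.ext (Subtype.mk.inj h))
  have finr (W : Subobject S) : Finite {V : Set.Iic W //
      Nonempty ((V.1 : C) ≅ Cc) ∧ Nonempty (cokernel (Subobject.ofLE V.1 W V.2) ≅ B)} :=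
    Finite.of_injective (β := {V : Subobject S // Nonempty ((V : C) ≅ Cc)})
      (fun V => ⟨V.1.1, V.2.1⟩)
      fun _ _ h => Subtype.ext (Subtype.ext (Subtype.mk.inj h))
  simp_rw [mul_comm (hallNumber S A _), hl, hr]
  rw [finsum_mul_card_iso hrep _ (fun X => hallNumber X A B)
      (fun e => hallNumber_congr_iso e A B),
    finsum_mul_card_iso hrep _ (fun X => hallNumber X B Cc)
      (fun e => hallNumber_congr_iso e B Cc)]
  simp_rw [card_quotient_filtrations, card_subobject_filtrations]
  rw [← Nat.card_sigma, ← Nat.card_sigma]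
  exact Nat.card_congr
    { toFun := fun x => ⟨⟨x.2.1.1, x.2.2.2⟩, ⟨⟨x.1.1, x.2.1.2⟩, x.1.2, x.2.2.1⟩⟩
      invFun := fun x => ⟨⟨x.2.1.1, x.2.2.1⟩, ⟨⟨x.1.1, x.2.1.2⟩, x.2.2.2, x.1.2⟩⟩
      left_inv := fun _ => rfl
      right_inv := fun _ => rfl }
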